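/- In the setting of the Santaló-point stability lemma (see context: d ≥ 2, K₀ a convex body in ℝ^d, 0 < ε₁ ≤ min{1/2, 2^{−2d−1}·(κ_{d−1}/(d·κ_d²))·|K₀|/(diam K₀)^d}, K a convex body with (1−ε₁)·K₀ ⊆ K ⊆ (1+ε₁)·K₀), suppose in addition that ε₂ > 0, that |K₀|·|(K₀−s(K₀))*| ≤ |K|·|(K−s(K))*|, and that c is a point in the interior of K with |K|·|(K−c)*| ≤ |K₀|·|(K₀−s(K₀))*| + ε₂ ≤ κ_d². Then ‖c − s(K₀)‖ ≤ c₁(K₀)·ε₁ + c₂(K₀)·√ε₂, where c₁(K₀) := (diam K₀)^{(d+1)²}·|K₀|^{−d−2}·d·(d·κ_d/κ_{d−1})^{d+2} and c₂(K₀) := √((diam K₀)^{d+2}/|K₀|)·√(2^{d+3}/((d+1)·κ_d)). -/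

import Mathlib

open MeasureTheory Pointwise Real
open scoped RealInnerProductSpace

/-- `d`-dimensional Lebesgue measure (volume) of a subset of `ℝ^d`. -/
noncomputable def vol {d : ℕ} (K : Set (EuclideanSpace ℝ (Fin d))) : ℝ := (volume K).toReal

/-- The polar body `K* = {x : ⟨x,y⟩ ≤ 1 for all y ∈ K}`. -/
def polarBody {d : ℕ} (K : Set (EuclideanSpace ℝ (Fin d))) : Set (EuclideanSpace ℝ (Fin d)) :=
  {x | ∀ y ∈ K, ⟪x, y⟫ ≤ 1}

/-- A convex body: a compact convex set with nonempty interior. -/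
def IsConvexBody {d : ℕ} (K : Set (EuclideanSpace ℝ (Fin d))) : Prop :=
  Convex ℝ K ∧ IsCompact K ∧ (interior K).Nonempty

/-- `κ_m`, the volume of the Euclidean unit ball in `ℝ^m`. -/
noncomputable def unitBallVol (m : ℕ) : ℝ :=
  (volume (Metric.ball (0 : EuclideanSpace ℝ (Fin m)) 1)).toReal

/-- `s` is a Santaló point of `K`: an interior point minimizing `z ↦ |(K−z)*|`. -/
def IsSantaloPoint {d : ℕ} (K : Set (EuclideanSpace ℝ (Fin d)))
    (s : EuclideanSpace ℝ (Fin d)) : Prop :=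
  s ∈ interior K ∧
    ∀ z ∈ interior K, vol (polarBody ((· - s) '' K)) ≤ vol (polarBody ((· - z) '' K))

lemma unitBallVol_pos (n : ℕ) : 0 < unitBallVol n :=
  ENNReal.toReal_pos (Metric.measure_ball_pos _ _ one_pos).ne' measure_ball_lt_top.ne

/-- The radial moments of `exp (-R * ‖u‖)`. -/
lemma integral_norm_pow_mul_exp {n : ℕ} (hn : 1 ≤ n) (k : ℕ) {R : ℝ} (hR : 0 < R) :
    Integrable (fun u : EuclideanSpace ℝ (Fin n) => ‖u‖ ^ k * rexp (-(R * ‖u‖))) ∧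
    ∫ u : EuclideanSpace ℝ (Fin n), ‖u‖ ^ k * rexp (-(R * ‖u‖)) =
      n * unitBallVol n * ((n + k - 1).factorial / R ^ (n + k)) := by
  have : Nonempty (Fin n) := ⟨⟨0, hn⟩⟩
  have key : ∫ t : ℝ in Set.Ioi 0, t ^ (n - 1) * (t ^ k * rexp (-(R * t))) =
      (n + k - 1).factorial / R ^ (n + k) := by
    have h := Real.integral_rpow_mul_exp_neg_mul_Ioi (a := (n + k : ℕ)) (r := R)
      (by exact_mod_cast (by omega : 0 < n + k)) hR
    have e : ((n + k : ℕ) : ℝ) = ((n + k - 1 : ℕ) : ℝ) + 1 := by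
      exact_mod_cast (by omega : n + k = n + k - 1 + 1)
    have hG : Real.Gamma ((n + k : ℕ) : ℝ) = (n + k - 1).factorial := by
      rw [e, Real.Gamma_nat_eq_factorial]
    rw [hG, Real.rpow_natCast] at h
    have h2 : ((n + k : ℕ) : ℝ) - 1 = ((n + k - 1 : ℕ) : ℝ) := by rw [e]; ring
    rw [h2] at h
    rw [one_div, inv_pow, mul_comm, ← div_eq_mul_inv] at h
    rw [← h]
    refine setIntegral_congr_fun measurableSet_Ioi fun t _ => ?_
    rw [← mul_assoc, ← pow_add, Real.rpow_natCast]
    congr 2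
    omega
  have hpos : (0 : ℝ) < (n + k - 1).factorial / R ^ (n + k) := by positivity
  constructor
  · refine (integrable_fun_norm_addHaar (volume : Measure (EuclideanSpace ℝ (Fin n)))
      (f := fun t => t ^ k * rexp (-(R * t)))).2 ?_
    refine .of_integral_ne_zero ?_
    simp only [finrank_euclideanSpace, Fintype.card_fin, smul_eq_mul]
    rw [key]
    exact hpos.ne'
  · rw [integral_fun_norm_addHaar (volume : Measure (EuclideanSpace ℝ (Fin n)))
      (fun t => t ^ k * rexp (-(R * t)))]
    simp only [finrank_euclideanSpace, Fintype.card_fin, smul_eq_mul, nsmul_eq_mul]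
    rw [key]
    simp [unitBallVol, Measure.real, mul_assoc]

/-- A linear isometry between unit vectors. -/
lemma exists_linearIsometryEquiv_apply_eq {F : Type*} [NormedAddCommGroup F]
    [InnerProductSpace ℝ F] [FiniteDimensional ℝ F] {v w : F} (h : ‖v‖ = ‖w‖) :
    ∃ T : F ≃ₗᵢ[ℝ] F, T v = w :=
  ⟨_, Submodule.reflection_sub h⟩

lemma integral_inner_sq_mul_exp {n : ℕ} (hn : 1 ≤ n) {R : ℝ} (hR : 0 < R)
    (w : EuclideanSpace ℝ (Fin n)) :
    Integrable (fun u : EuclideanSpace ℝ (Fin n) => ⟪u, w⟫ ^ 2 * rexp (-(R * ‖u‖))) ∧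
    ∫ u : EuclideanSpace ℝ (Fin n), ⟪u, w⟫ ^ 2 * rexp (-(R * ‖u‖)) =
      ‖w‖ ^ 2 * (unitBallVol n * ((n + 1).factorial / R ^ (n + 2))) := by
  have hint : ∀ w : EuclideanSpace ℝ (Fin n),
      Integrable (fun u : EuclideanSpace ℝ (Fin n) => ⟪u, w⟫ ^ 2 * rexp (-(R * ‖u‖))) := by
    intro w
    refine ((integral_norm_pow_mul_exp hn 2 hR).1.const_mul (‖w‖ ^ 2)).mono'
      (by fun_prop) (ae_of_all _ fun u => ?_)
    rw [Real.norm_of_nonneg (by positivity), ← mul_assoc]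
    gcongr
    rw [← mul_pow, ← sq_abs, mul_comm]
    gcongr
    exact abs_real_inner_le_norm _ _
  refine ⟨hint w, ?_⟩
  set e : Fin n → EuclideanSpace ℝ (Fin n) := fun i => EuclideanSpace.single i 1 with he
  have hnorm : ∀ i, ‖e i‖ = 1 := fun i => by simp [he]
  have hsame : ∀ i, ∫ u : EuclideanSpace ℝ (Fin n), ⟪u, w⟫ ^ 2 * rexp (-(R * ‖u‖)) =
      ‖w‖ ^ 2 * ∫ u : EuclideanSpace ℝ (Fin n), ⟪u, e i⟫ ^ 2 * rexp (-(R * ‖u‖)) := by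
    intro i
    obtain ⟨T, hT⟩ := exists_linearIsometryEquiv_apply_eq (v := ‖w‖ • e i) (w := w)
      (by simp [norm_smul, hnorm])
    rw [← (T.measurePreserving).integral_comp' (f := T.toMeasurableEquiv), ← integral_const_mul]
    congr 1
    ext u
    simp only [LinearIsometryEquiv.coe_toMeasurableEquiv]
    conv_lhs => rw [← hT]
    rw [T.inner_map_map, T.norm_map, inner_smul_right]
    ring
  have hsum : ∑ i, ∫ u : EuclideanSpace ℝ (Fin n), ⟪u, e i⟫ ^ 2 * rexp (-(R * ‖u‖)) =
      n * unitBallVol n * ((n + 1).factorial / R ^ (n + 2)) := by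
    have := (integral_norm_pow_mul_exp hn 2 hR).2
    rw [show n + 2 - 1 = n + 1 by omega] at this
    rw [← integral_finsetSum _ fun i _ => hint (e i), ← this]
    congr 1
    ext u
    rw [← Finset.sum_mul]
    congr 1
    rw [EuclideanSpace.real_norm_sq_eq]
    simp [he, EuclideanSpace.inner_single_right]
  have hn0 : (n : ℝ) ≠ 0 := by positivity
  have h3 : (n : ℝ) * ∫ u : EuclideanSpace ℝ (Fin n), ⟪u, w⟫ ^ 2 * rexp (-(R * ‖u‖)) =
      ‖w‖ ^ 2 * (n * unitBallVol n * ((n + 1).factorial / R ^ (n + 2))) := by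
    rw [← hsum, Finset.mul_sum, ← Finset.sum_congr rfl fun i _ => hsame i]
    simp
  apply mul_left_cancel₀ hn0
  rw [h3]
  ring

lemma integrable_norm_pow_mul_exp_neg {n : ℕ} (hn : 1 ≤ n) (k : ℕ) {ρ : ℝ} (hρ : 0 < ρ)
    {g : EuclideanSpace ℝ (Fin n) → ℝ} (hg : Continuous g) (hgρ : ∀ u, ρ * ‖u‖ ≤ g u) :
    Integrable (fun u => ‖u‖ ^ k * rexp (-g u)) := by
  refine (integral_norm_pow_mul_exp hn k hρ).1.mono' (by fun_prop) (ae_of_all _ fun u => ?_)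
  rw [Real.norm_of_nonneg (by positivity)]
  gcongr
  exact hgρ u

lemma integrable_exp_neg {n : ℕ} (hn : 1 ≤ n) {ρ : ℝ} (hρ : 0 < ρ)
    {g : EuclideanSpace ℝ (Fin n) → ℝ} (hg : Continuous g) (hgρ : ∀ u, ρ * ‖u‖ ≤ g u) :
    Integrable (fun u => rexp (-g u)) := by
  simpa using integrable_norm_pow_mul_exp_neg hn 0 hρ hg hgρ

lemma integrable_inner_sq_mul_exp_neg {n : ℕ} (hn : 1 ≤ n) {ρ : ℝ} (hρ : 0 < ρ)
    {g : EuclideanSpace ℝ (Fin n) → ℝ} (hg : Continuous g) (hgρ : ∀ u, ρ * ‖u‖ ≤ g u)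
    (w : EuclideanSpace ℝ (Fin n)) :
    Integrable (fun u => ⟪u, w⟫ ^ 2 * rexp (-g u)) := by
  refine (integral_inner_sq_mul_exp hn hρ w).1.mono' (by fun_prop) (ae_of_all _ fun u => ?_)
  rw [Real.norm_of_nonneg (by positivity)]
  gcongr
  exact hgρ u

/-- Symmetrization: an even weight integrates at least as much against `exp (-g)` as against
`exp (-R‖u‖)` if `g u + g (-u) ≤ 2 * R * ‖u‖`. -/
lemma integral_mul_exp_le_of_add_neg_le {n : ℕ} {R : ℝ}
    {g φ : EuclideanSpace ℝ (Fin n) → ℝ} (hφ : ∀ u, 0 ≤ φ u) (hφe : ∀ u, φ (-u) = φ u)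
    (hgR : ∀ u, g u + g (-u) ≤ 2 * R * ‖u‖)
    (hi1 : Integrable fun u => φ u * rexp (-g u))
    (hi2 : Integrable fun u => φ u * rexp (-(R * ‖u‖))) :
    ∫ u, φ u * rexp (-(R * ‖u‖)) ≤ ∫ u, φ u * rexp (-g u) := by
  have h1 : ∫ u, φ u * rexp (-g (-u)) = ∫ u, φ u * rexp (-g u) := by
    rw [← integral_neg_eq_self (fun u => φ u * rexp (-g u)) volume]
    simp [hφe]
  have hi3 : Integrable fun u => φ u * rexp (-g (-u)) := by
    simpa [hφe] using hi1.comp_neg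
  have h2 : ∫ u, (2 * (φ u * rexp (-(R * ‖u‖)))) ≤
      ∫ u, (φ u * rexp (-g u) + φ u * rexp (-g (-u))) := by
    refine integral_mono (hi2.const_mul 2) (hi1.add hi3) fun u => ?_
    simp only
    have h4 : 2 * rexp (-(R * ‖u‖)) ≤ rexp (-g u) + rexp (-g (-u)) := by
      have h5 : rexp (-(R * ‖u‖)) ≤ rexp (-g u / 2) * rexp (-g (-u) / 2) := by
        rw [← Real.exp_add]
        apply Real.exp_le_exp.2
        linarith [hgR u]
      have e1 : rexp (-g u) = rexp (-g u / 2) ^ 2 := by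
        rw [← Real.exp_nat_mul]; congr 1; push_cast; ring
      have e2 : rexp (-g (-u)) = rexp (-g (-u) / 2) ^ 2 := by
        rw [← Real.exp_nat_mul]; congr 1; push_cast; ring
      rw [e1, e2]
      nlinarith [sq_nonneg (rexp (-g u / 2) - rexp (-g (-u) / 2))]
    nlinarith [mul_le_mul_of_nonneg_left h4 (hφ u)]
  rw [integral_const_mul, integral_add hi1 hi3, h1] at h2
  linarith

/-- The volume of a sublevel set of a positively homogeneous function as an exponential
integral. -/
lemma integral_exp_neg_eq_factorial_mul_volume {n : ℕ} (hn : 1 ≤ n) {ρ : ℝ} (hρ : 0 < ρ)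
    {g : EuclideanSpace ℝ (Fin n) → ℝ} (hg : Continuous g) (hgρ : ∀ u, ρ * ‖u‖ ≤ g u)
    (hhom : ∀ t : ℝ, 0 ≤ t → ∀ u, g (t • u) = t * g u) :
    ∫ u, rexp (-g u) = n.factorial * vol {u | g u ≤ 1} := by
  have hg0 : ∀ u, 0 ≤ g u := fun u => le_trans (by positivity) (hgρ u)
  have hexp : ∀ a : ℝ, 0 ≤ a → ENNReal.ofReal (rexp (-a)) =
      ∫⁻ r in Set.Ioi 0, Set.indicator (Set.Ici a) (fun r => ENNReal.ofReal (rexp (-r))) r := by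
    intro a ha
    rw [setLIntegral_indicator measurableSet_Ici]
    rw [setLIntegral_congr (t := Set.Ioi a)]
    · rw [← ofReal_integral_eq_lintegral_ofReal (integrableOn_exp_neg_Ioi a)
        (ae_of_all _ fun r => (Real.exp_pos _).le), integral_exp_neg_Ioi]
    · rcases ha.eq_or_lt with rfl | ha
      · rw [Set.inter_eq_right.2 Set.Ioi_subset_Ici_self]
        exact Filter.EventuallyEq.rfl
      · rw [Set.inter_eq_left.2 (Set.Ici_subset_Ioi.2 ha)]
        exact Ioi_ae_eq_Ici.symm
  have hscale : ∀ r : ℝ, 0 < r → volume {u | g u ≤ r} =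
      ENNReal.ofReal (r ^ n) * volume {u | g u ≤ 1} := by
    intro r hr
    have : {u | g u ≤ r} = r • {u | g u ≤ 1} := by
      ext u
      rw [Set.mem_smul_set_iff_inv_smul_mem₀ hr.ne', Set.mem_ofPred_eq, Set.mem_ofPred_eq,
        hhom _ (by positivity), inv_mul_le_iff₀ hr, mul_one]
    rw [this, Measure.addHaar_smul]
    simp [abs_of_pos (pow_pos hr n)]
  have hG : ∫⁻ r in Set.Ioi (0:ℝ), ENNReal.ofReal (r ^ n * rexp (-r)) = n.factorial := by
    have h := Real.integral_rpow_mul_exp_neg_mul_Ioi (a := (n : ℝ) + 1) (r := 1)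
      (by positivity) one_pos
    simp only [add_sub_cancel_right, Real.rpow_natCast, one_mul, div_one, Real.one_rpow,
      Real.Gamma_nat_eq_factorial] at h
    rw [← ofReal_integral_eq_lintegral_ofReal _ _, h]
    · simp
    · refine Integrable.of_integral_ne_zero ?_
      rw [h]
      positivity
    · refine (ae_restrict_iff' measurableSet_Ioi).2 (ae_of_all _ fun r hr => ?_)
      have : (0:ℝ) < r := hr
      simp only [Pi.zero_apply]
      positivity
  have hmain : ∫⁻ u, ENNReal.ofReal (rexp (-g u)) = n.factorial * volume {u | g u ≤ 1} := by
    calc ∫⁻ u, ENNReal.ofReal (rexp (-g u))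
        = ∫⁻ u, ∫⁻ r in Set.Ioi (0:ℝ), Set.indicator {p : EuclideanSpace ℝ (Fin n) × ℝ | g p.1 ≤ p.2}
            (fun p => ENNReal.ofReal (rexp (-p.2))) (u, r) := by
          refine lintegral_congr fun u => ?_
          rw [hexp _ (hg0 u)]
          rfl
      _ = ∫⁻ r in Set.Ioi (0:ℝ), ∫⁻ u, Set.indicator {p : EuclideanSpace ℝ (Fin n) × ℝ | g p.1 ≤ p.2}
            (fun p => ENNReal.ofReal (rexp (-p.2))) (u, r) := by
          refine lintegral_lintegral_swap (Measurable.aemeasurable ?_)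
          refine Measurable.indicator (by fun_prop) ?_
          exact measurableSet_le (by fun_prop) (by fun_prop)
      _ = ∫⁻ r in Set.Ioi (0:ℝ), ENNReal.ofReal (r ^ n * rexp (-r)) * volume {u | g u ≤ 1} := by
          refine setLIntegral_congr_fun measurableSet_Ioi fun r hr => ?_
          have hr : (0:ℝ) < r := hr
          have : ∀ u, Set.indicator {p : EuclideanSpace ℝ (Fin n) × ℝ | g p.1 ≤ p.2}
            (fun p => ENNReal.ofReal (rexp (-p.2))) (u, r) =
              Set.indicator {u | g u ≤ r} (fun _ => ENNReal.ofReal (rexp (-r))) u := fun u => rfl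
          simp only [this]
          rw [lintegral_indicator_const (measurableSet_le (by fun_prop) (by fun_prop)), hscale r hr,
            ENNReal.ofReal_mul (by positivity)]
          ring
      _ = n.factorial * volume {u | g u ≤ 1} := by
          rw [lintegral_mul_const _ (by fun_prop), hG]
  rw [integral_eq_lintegral_of_nonneg_ae (ae_of_all _ fun u => (Real.exp_pos _).le)
    (by fun_prop), hmain]
  simp [vol]

/-- Lower bound for the exponential integral of a sublinear function in terms of its value at
a unit vector. -/
lemma le_mul_integral_exp_neg {n : ℕ} (hn : 1 ≤ n) {ρ R : ℝ} (hρ : 0 < ρ) (hR : 0 < R)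
    {g : EuclideanSpace ℝ (Fin (n + 1)) → ℝ} (hg : Continuous g) (hgρ : ∀ u, ρ * ‖u‖ ≤ g u)
    (hhom : ∀ t : ℝ, 0 ≤ t → ∀ u, g (t • u) = t * g u)
    (hadd : ∀ u v, g (u + v) ≤ g u + g v)
    (hgR : ∀ u, g u + g (-u) ≤ 2 * R * ‖u‖)
    {u₀ : EuclideanSpace ℝ (Fin (n + 1))} (hu₀ : ‖u₀‖ = 1) :
    unitBallVol n * (n.factorial / R ^ n) ≤ g u₀ * ∫ u, rexp (-g u) := by
  have hδ : 0 < g u₀ := lt_of_lt_of_le (by rw [hu₀]; linarith) (hgρ u₀)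
  obtain ⟨T, hT⟩ : ∃ T : WithLp 2 (ℝ × EuclideanSpace ℝ (Fin n)) ≃ₗᵢ[ℝ] EuclideanSpace ℝ (Fin (n + 1)),
      T (WithLp.toLp 2 (1, 0)) = u₀ := by
    have hfr : Module.finrank ℝ (WithLp 2 (ℝ × EuclideanSpace ℝ (Fin n))) =
        Module.finrank ℝ (EuclideanSpace ℝ (Fin (n + 1))) := by
      rw [(WithLp.linearEquiv 2 ℝ (ℝ × EuclideanSpace ℝ (Fin n))).finrank_eq]
      simp [add_comm]
    let S := (stdOrthonormalBasis ℝ (WithLp 2 (ℝ × EuclideanSpace ℝ (Fin n)))).equiv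
      (stdOrthonormalBasis ℝ (EuclideanSpace ℝ (Fin (n + 1)))) (finCongr hfr)
    obtain ⟨T, hT⟩ := exists_linearIsometryEquiv_apply_eq
      (v := S (WithLp.toLp 2 (1, 0))) (w := u₀) (by
        rw [S.norm_map, hu₀, WithLp.prod_norm_eq_of_L2]; simp)
    exact ⟨S.trans T, hT⟩
  set J : EuclideanSpace ℝ (Fin n) → EuclideanSpace ℝ (Fin (n + 1)) := fun v => T (WithLp.toLp 2 (0, v)) with hJ
  have hJn : ∀ v, ‖J v‖ = ‖v‖ := fun v => by
    rw [hJ]; simp only [T.norm_map, WithLp.prod_norm_eq_of_L2]; simp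
  have hJneg : ∀ v, J (-v) = - J v := fun v => by
    simp only [hJ]; rw [← map_neg]; congr 1; rw [WithLp.ext_iff]; ext <;> simp
  have hJc : Continuous J := by fun_prop
  have hdec : ∀ (t : ℝ) (v : EuclideanSpace ℝ (Fin n)), T (WithLp.toLp 2 (t, v)) = t • u₀ + J v := fun t v => by
    rw [← hT, hJ, ← map_smul, ← map_add]; congr 1; rw [WithLp.ext_iff]; ext <;> simp
  have hgJρ : ∀ v, ρ * ‖v‖ ≤ g (J v) := fun v => by rw [← hJn]; exact hgρ _
  have hiJ : Integrable fun v => rexp (-g (J v)) :=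
    integrable_exp_neg hn hρ (hg.comp hJc) hgJρ
  have hmp : MeasurePreserving (fun p : ℝ × EuclideanSpace ℝ (Fin n) => T (WithLp.toLp 2 p)) :=
    T.measurePreserving.comp (WithLp.volume_preserving_toLp ℝ (EuclideanSpace ℝ (Fin n)))
  have hme : MeasurableEmbedding (fun p : ℝ × EuclideanSpace ℝ (Fin n) => T (WithLp.toLp 2 p)) :=
    (T.toMeasurableEquiv.measurableEmbedding).comp
      (MeasurableEquiv.toLp 2 (ℝ × EuclideanSpace ℝ (Fin n))).measurableEmbedding
  have hi : Integrable fun u => rexp (-g u) := integrable_exp_neg (by omega) hρ hg hgρ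
  have hint1 : Integrable ((Set.Ioi (0:ℝ)).indicator fun t => rexp (-(g u₀) * t)) := by
    rw [integrable_indicator_iff measurableSet_Ioi]
    exact integrableOn_exp_mul_Ioi (by linarith) 0
  have h1 : ∫ t, (Set.Ioi (0:ℝ)).indicator (fun t => rexp (-(g u₀) * t)) t = 1 / g u₀ := by
    rw [integral_indicator measurableSet_Ioi, integral_exp_mul_Ioi (by linarith)]
    simp
  have h2 : unitBallVol n * (n.factorial / R ^ n) ≤ ∫ v, rexp (-g (J v)) := by
    have := integral_norm_pow_mul_exp hn 0 hR
    have h3 := integral_mul_exp_le_of_add_neg_le (n := n) (R := R) (g := fun v => g (J v))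
      (φ := fun _ => 1) (by simp) (by simp) (fun v => by rw [hJneg, ← hJn]; exact hgR _)
      (by simpa using hiJ) (by simpa using this.1)
    simp only [pow_zero] at this
    rw [this.2] at h3
    simp only [one_mul] at h3
    refine le_trans (le_of_eq ?_) h3
    obtain ⟨m, rfl⟩ : ∃ m, n = m + 1 := ⟨n - 1, by omega⟩
    simp [Nat.factorial_succ]
    ring
  have h4 : (1 / g u₀) * ∫ v, rexp (-g (J v)) ≤ ∫ u, rexp (-g u) := by
    rw [← h1, ← integral_prod_mul, ← Measure.volume_eq_prod, ← hmp.integral_comp hme]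
    refine integral_mono (hint1.mul_prod hiJ) ((hmp.integrable_comp_emb hme).2 hi) fun p => ?_
    obtain ⟨t, v⟩ := p
    simp only
    by_cases ht : t ∈ Set.Ioi (0:ℝ)
    · rw [Set.indicator_of_mem ht, ← Real.exp_add]
      apply Real.exp_le_exp.2
      rw [hdec]
      have ht' : 0 ≤ t := le_of_lt ht
      have := hadd (t • u₀) (J v)
      rw [hhom t ht'] at this
      linarith
    · rw [Set.indicator_of_notMem ht]
      simp only [zero_mul]
      positivity
  calc unitBallVol n * (n.factorial / R ^ n) ≤ ∫ v, rexp (-g (J v)) := h2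
    _ = g u₀ * ((1 / g u₀) * ∫ v, rexp (-g (J v))) := by field_simp
    _ ≤ _ := by gcongr
/-- The support function of a set. -/
noncomputable def supportFn {n : ℕ} (K : Set (EuclideanSpace ℝ (Fin n)))
    (u : EuclideanSpace ℝ (Fin n)) : ℝ :=
  sSup ((fun y => ⟪u, y⟫) '' K)

section supportFn

variable {n : ℕ} {K : Set (EuclideanSpace ℝ (Fin n))}

lemma continuous_supportFn (hK : IsCompact K) : Continuous (supportFn K) :=
  hK.continuous_sSup (f := fun u y => ⟪u, y⟫) (by
    change Continuous fun p : EuclideanSpace ℝ (Fin n) × EuclideanSpace ℝ (Fin n) => ⟪p.1, p.2⟫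
    fun_prop)

lemma inner_le_supportFn (hK : IsCompact K) {y : EuclideanSpace ℝ (Fin n)} (hy : y ∈ K)
    (u : EuclideanSpace ℝ (Fin n)) : ⟪u, y⟫ ≤ supportFn K u :=
  le_csSup (hK.image (by fun_prop)).bddAbove ⟨y, hy, rfl⟩

lemma supportFn_le_iff (hK : IsCompact K) (hne : K.Nonempty) {u : EuclideanSpace ℝ (Fin n)}
    {a : ℝ} : supportFn K u ≤ a ↔ ∀ y ∈ K, ⟪u, y⟫ ≤ a := by
  refine ⟨fun h y hy => (inner_le_supportFn hK hy u).trans h, fun h => ?_⟩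
  refine csSup_le (hne.image _) ?_
  rintro _ ⟨y, hy, rfl⟩
  exact h y hy

lemma supportFn_smul {t : ℝ} (ht : 0 ≤ t) (u : EuclideanSpace ℝ (Fin n)) :
    supportFn K (t • u) = t * supportFn K u := by
  rw [supportFn, supportFn, ← smul_eq_mul, ← Real.sSup_smul_of_nonneg ht]
  congr 1
  ext x
  simp [Set.mem_smul_set, inner_smul_left]

lemma supportFn_add_le (hK : IsCompact K) (hne : K.Nonempty) (u v : EuclideanSpace ℝ (Fin n)) :
    supportFn K (u + v) ≤ supportFn K u + supportFn K v := by
  rw [supportFn_le_iff hK hne]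
  intro y hy
  rw [inner_add_left]
  exact add_le_add (inner_le_supportFn hK hy u) (inner_le_supportFn hK hy v)

lemma supportFn_sub_inner_le (hK : IsCompact K) {p : EuclideanSpace ℝ (Fin n)} (hp : p ∈ K)
    (u : EuclideanSpace ℝ (Fin n)) : supportFn K u - ⟪u, p⟫ ≤ Metric.diam K * ‖u‖ := by
  rw [sub_le_iff_le_add, supportFn_le_iff hK ⟨p, hp⟩]
  intro y hy
  rw [← sub_le_iff_le_add, ← inner_sub_right]
  refine (real_inner_le_norm _ _).trans ?_
  rw [mul_comm, ← dist_eq_norm]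
  gcongr
  exact Metric.dist_le_diam_of_mem hK.isBounded hy hp

lemma supportFn_add_neg_le (hK : IsCompact K) (hne : K.Nonempty)
    (u : EuclideanSpace ℝ (Fin n)) : supportFn K u + supportFn K (-u) ≤ Metric.diam K * ‖u‖ := by
  rw [← le_sub_iff_add_le', supportFn_le_iff hK hne]
  intro y hy
  have := supportFn_sub_inner_le hK hy u
  rw [inner_neg_left]
  linarith

lemma supportFn_mono {L : Set (EuclideanSpace ℝ (Fin n))} (hL : IsCompact L) (hne : K.Nonempty)
    (h : K ⊆ L) (u : EuclideanSpace ℝ (Fin n)) : supportFn K u ≤ supportFn L u :=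
  csSup_le_csSup (hL.image (by fun_prop)).bddAbove (hne.image _) (Set.image_mono h)

lemma supportFn_smul_set {t : ℝ} (ht : 0 ≤ t) (u : EuclideanSpace ℝ (Fin n)) :
    supportFn (t • K) u = t * supportFn K u := by
  rw [supportFn, supportFn, ← smul_eq_mul, ← Real.sSup_smul_of_nonneg ht]
  congr 1
  ext x
  simp [Set.mem_smul_set, inner_smul_right]

lemma exists_pos_mul_norm_le_supportFn_sub (hK : IsCompact K) {p : EuclideanSpace ℝ (Fin n)}
    (hp : p ∈ interior K) :
    ∃ ρ > 0, ∀ u, ρ * ‖u‖ ≤ supportFn K u - ⟪u, p⟫ := by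
  obtain ⟨ρ, hρ, hb⟩ := Metric.nhds_basis_closedBall.mem_iff.1 (mem_interior_iff_mem_nhds.1 hp)
  refine ⟨ρ, hρ, fun u => ?_⟩
  rcases eq_or_ne u 0 with rfl | hu
  · have := inner_le_supportFn hK (interior_subset hp) 0
    simpa using this
  have hu' : 0 < ‖u‖ := norm_pos_iff.2 hu
  have hmem : p + (ρ / ‖u‖) • u ∈ K := by
    apply hb
    rw [Metric.mem_closedBall, dist_eq_norm, add_sub_cancel_left, norm_smul, Real.norm_of_nonneg
      (by positivity), div_mul_cancel₀ _ hu'.ne']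
  have := inner_le_supportFn hK hmem u
  rw [inner_add_right, inner_smul_right, real_inner_self_eq_norm_sq] at this
  have e : ρ / ‖u‖ * ‖u‖ ^ 2 = ρ * ‖u‖ := by field_simp
  linarith

lemma polarBody_image_sub (hK : IsCompact K) (hne : K.Nonempty) (p : EuclideanSpace ℝ (Fin n)) :
    polarBody ((· - p) '' K) = {u | supportFn K u - ⟪u, p⟫ ≤ 1} := by
  ext u
  rw [Set.mem_ofPred_eq, sub_le_iff_le_add, supportFn_le_iff hK hne]
  simp only [polarBody, Set.mem_ofPred_eq, Set.forall_mem_image, inner_sub_right,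
    sub_le_iff_le_add]

lemma integral_exp_eq_factorial_mul_vol_polarBody (hn : 1 ≤ n) (hK : IsCompact K)
    {p : EuclideanSpace ℝ (Fin n)} (hp : p ∈ interior K) :
    ∫ u, rexp (-(supportFn K u - ⟪u, p⟫)) = n.factorial * vol (polarBody ((· - p) '' K)) := by
  obtain ⟨ρ, hρ, h⟩ := exists_pos_mul_norm_le_supportFn_sub hK hp
  rw [polarBody_image_sub hK ⟨p, interior_subset hp⟩]
  refine integral_exp_neg_eq_factorial_mul_volume hn hρ
    ((continuous_supportFn hK).sub (by fun_prop)) h fun t ht u => ?_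
  rw [supportFn_smul ht, real_inner_smul_left]
  ring

end supportFn

lemma two_add_sq_le_exp_add_exp_neg (x : ℝ) : 2 + x ^ 2 ≤ rexp x + rexp (-x) := by
  wlog hx : 0 ≤ x generalizing x
  · have := this (-x) (by linarith)
    rw [neg_neg, neg_sq] at this
    linarith
  have h := Real.self_le_sinh_iff.2 (by linarith : 0 ≤ x / 2)
  rw [Real.sinh_eq] at h
  have e1 : rexp x = rexp (x / 2) ^ 2 := by rw [← Real.exp_nat_mul]; congr 1; push_cast; ring
  have e2 : rexp (-x) = rexp (-(x / 2)) ^ 2 := by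
    rw [← Real.exp_nat_mul]; congr 1; push_cast; ring
  have e3 : rexp (x / 2) * rexp (-(x / 2)) = 1 := by rw [← Real.exp_add]; simp
  have h2 : x ^ 2 ≤ (rexp (x / 2) - rexp (-(x / 2))) ^ 2 := by
    apply pow_le_pow_left₀ hx
    linarith
  rw [e1, e2]
  nlinarith

/-- Strong midpoint convexity of `p ↦ ∫ exp (-(h u - ⟪u, p⟫))`. -/
lemma integral_exp_midpoint_add_le {n : ℕ} (hn : 1 ≤ n) {ρ R : ℝ} (hρ : 0 < ρ) (hR : 0 < R)
    {h : EuclideanSpace ℝ (Fin n) → ℝ} (hh : Continuous h)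
    (hhR : ∀ u, h u + h (-u) ≤ 2 * R * ‖u‖) {p q : EuclideanSpace ℝ (Fin n)}
    (hp : ∀ u, ρ * ‖u‖ ≤ h u - ⟪u, p⟫) (hq : ∀ u, ρ * ‖u‖ ≤ h u - ⟪u, q⟫) :
    2 * (∫ u, rexp (-(h u - ⟪u, midpoint ℝ p q⟫))) +
      ‖p - q‖ ^ 2 / 4 * (unitBallVol n * ((n + 1).factorial / R ^ (n + 2))) ≤
    (∫ u, rexp (-(h u - ⟪u, p⟫))) + ∫ u, rexp (-(h u - ⟪u, q⟫)) := by
  have hmid : ∀ u, ⟪u, midpoint ℝ p q⟫ = (⟪u, p⟫ + ⟪u, q⟫) / 2 := fun u => by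
    rw [midpoint_eq_smul_add, inner_smul_right, inner_add_right]
    simp; ring
  have hm : ∀ u, ρ * ‖u‖ ≤ h u - ⟪u, midpoint ℝ p q⟫ := fun u => by
    rw [hmid]; linarith [hp u, hq u]
  have hc : ∀ z : EuclideanSpace ℝ (Fin n), Continuous fun u => h u - ⟪u, z⟫ :=
    fun z => hh.sub (by fun_prop)
  have hip := integrable_exp_neg hn hρ (hc p) hp
  have hiq := integrable_exp_neg hn hρ (hc q) hq
  have him := integrable_exp_neg hn hρ (hc _) hm
  have hi2 := integrable_inner_sq_mul_exp_neg hn hρ (hc _) hm (p - q)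
  have hlow := integral_mul_exp_le_of_add_neg_le (R := R) (φ := fun u => ⟪u, p - q⟫ ^ 2)
    (g := fun u => h u - ⟪u, midpoint ℝ p q⟫) (fun u => sq_nonneg _) (fun u => by simp)
    (fun u => by rw [inner_neg_left]; linarith [hhR u]) hi2
    (integral_inner_sq_mul_exp hn hR (p - q)).1
  rw [(integral_inner_sq_mul_exp hn hR (p - q)).2] at hlow
  have hmono : ∫ u, (2 * rexp (-(h u - ⟪u, midpoint ℝ p q⟫)) +
      1 / 4 * (⟪u, p - q⟫ ^ 2 * rexp (-(h u - ⟪u, midpoint ℝ p q⟫)))) ≤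
      ∫ u, (rexp (-(h u - ⟪u, p⟫)) + rexp (-(h u - ⟪u, q⟫))) := by
    refine integral_mono ((him.const_mul 2).add (hi2.const_mul (1 / 4))) (hip.add hiq) fun u => ?_
    simp only
    have e1 : rexp (-(h u - ⟪u, p⟫)) =
        rexp (-(h u - ⟪u, midpoint ℝ p q⟫)) * rexp (⟪u, p - q⟫ / 2) := by
      rw [← Real.exp_add, hmid, inner_sub_right]; congr 1; ring
    have e2 : rexp (-(h u - ⟪u, q⟫)) =
        rexp (-(h u - ⟪u, midpoint ℝ p q⟫)) * rexp (-(⟪u, p - q⟫ / 2)) := by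
      rw [← Real.exp_add, hmid, inner_sub_right]; congr 1; ring
    rw [e1, e2]
    nlinarith [mul_le_mul_of_nonneg_left (two_add_sq_le_exp_add_exp_neg (⟪u, p - q⟫ / 2))
      (Real.exp_pos (-(h u - ⟪u, midpoint ℝ p q⟫))).le]
  rw [integral_add (him.const_mul 2) (hi2.const_mul (1 / 4)), integral_add hip hiq,
    integral_const_mul, integral_const_mul] at hmono
  linarith

/-- Quadratic growth of `p ↦ ∫ exp (-(h u - ⟪u, p⟫))` away from a minimizer. -/
lemma quadratic_growth_of_isMinOn {n : ℕ} (hn : 1 ≤ n) {R : ℝ} (hR : 0 < R)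
    {h : EuclideanSpace ℝ (Fin n) → ℝ} (hh : Continuous h)
    (hhR : ∀ u, h u + h (-u) ≤ 2 * R * ‖u‖) {U : Set (EuclideanSpace ℝ (Fin n))}
    (hU : Convex ℝ U) (hcoer : ∀ p ∈ U, ∃ ρ > 0, ∀ u, ρ * ‖u‖ ≤ h u - ⟪u, p⟫)
    {s : EuclideanSpace ℝ (Fin n)} (hs : s ∈ U)
    (hmin : ∀ p ∈ U, ∫ u, rexp (-(h u - ⟪u, s⟫)) ≤ ∫ u, rexp (-(h u - ⟪u, p⟫)))
    {c : EuclideanSpace ℝ (Fin n)} (hc : c ∈ U) :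
    (∫ u, rexp (-(h u - ⟪u, s⟫))) +
      3 / 8 * ‖s - c‖ ^ 2 * (unitBallVol n * ((n + 1).factorial / R ^ (n + 2))) ≤
    ∫ u, rexp (-(h u - ⟪u, c⟫)) := by
  have hstep : ∀ q ∈ U, 2 * (∫ u, rexp (-(h u - ⟪u, midpoint ℝ s q⟫))) +
      ‖s - q‖ ^ 2 / 4 * (unitBallVol n * ((n + 1).factorial / R ^ (n + 2))) ≤
      (∫ u, rexp (-(h u - ⟪u, s⟫))) + ∫ u, rexp (-(h u - ⟪u, q⟫)) := by
    intro q hq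
    obtain ⟨ρ₁, hρ₁, h₁⟩ := hcoer s hs
    obtain ⟨ρ₂, hρ₂, h₂⟩ := hcoer q hq
    refine integral_exp_midpoint_add_le hn (lt_min hρ₁ hρ₂) hR hh hhR (fun u => ?_) (fun u => ?_)
    · exact le_trans (by gcongr; exact min_le_left _ _) (h₁ u)
    · exact le_trans (by gcongr; exact min_le_right _ _) (h₂ u)
  have hm : midpoint ℝ s c ∈ U := hU.midpoint_mem hs hc
  have h1 := hstep c hc
  have h2 := hstep _ hm
  have h3 := hmin _ (hU.midpoint_mem hs hm)
  have h4 : ‖s - midpoint ℝ s c‖ = ‖s - c‖ / 2 := by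
    rw [← dist_eq_norm, dist_left_midpoint, dist_eq_norm]
    simp; ring
  rw [h4] at h2
  nlinarith

lemma abs_exp_sub_exp_le (a b : ℝ) : |rexp a - rexp b| ≤ |a - b| * rexp (max a b) := by
  wlog hab : b ≤ a generalizing a b
  · rw [abs_sub_comm, abs_sub_comm a, max_comm]
    exact this b a (le_of_not_ge hab)
  rw [abs_of_nonneg (sub_nonneg.2 (Real.exp_le_exp.2 hab)), abs_of_nonneg (sub_nonneg.2 hab),
    max_eq_left hab]
  have h1 := Real.add_one_le_exp (b - a)
  have h2 : rexp b = rexp a * rexp (b - a) := by rw [← Real.exp_add]; congr 1; ring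
  rw [h2]
  nlinarith [Real.exp_pos a]

/-- The difference of two functionals `p ↦ ∫ exp (-(h u - ⟪u, p⟫))` with nearby `h` is Lipschitz
with a small constant. -/
lemma integral_exp_sub_sub_le {n : ℕ} (hn : 1 ≤ n) {ρ η : ℝ} (hρ : 0 < ρ)
    {h₁ h₂ : EuclideanSpace ℝ (Fin n) → ℝ} (hh₁ : Continuous h₁) (hh₂ : Continuous h₂)
    (hη : ∀ u, |h₁ u - h₂ u| ≤ η * ‖u‖) {p q : EuclideanSpace ℝ (Fin n)}
    (h1p : ∀ u, ρ * ‖u‖ ≤ h₁ u - ⟪u, p⟫) (h1q : ∀ u, ρ * ‖u‖ ≤ h₁ u - ⟪u, q⟫)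
    (h2p : ∀ u, ρ * ‖u‖ ≤ h₂ u - ⟪u, p⟫) (h2q : ∀ u, ρ * ‖u‖ ≤ h₂ u - ⟪u, q⟫) :
    ((∫ u, rexp (-(h₁ u - ⟪u, p⟫))) - ∫ u, rexp (-(h₂ u - ⟪u, p⟫))) -
      ((∫ u, rexp (-(h₁ u - ⟪u, q⟫))) - ∫ u, rexp (-(h₂ u - ⟪u, q⟫))) ≤
    η * ‖p - q‖ * (n * unitBallVol n * ((n + 1).factorial / ρ ^ (n + 2))) := by
  have hi : ∀ {h : EuclideanSpace ℝ (Fin n) → ℝ} {z}, Continuous h →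
      (∀ u, ρ * ‖u‖ ≤ h u - ⟪u, z⟫) → Integrable fun u => rexp (-(h u - ⟪u, z⟫)) :=
    fun hh hz => integrable_exp_neg hn hρ (hh.sub (by fun_prop)) hz
  have i1p := hi hh₁ h1p
  have i1q := hi hh₁ h1q
  have i2p := hi hh₂ h2p
  have i2q := hi hh₂ h2q
  have hmom := integral_norm_pow_mul_exp hn 2 hρ
  rw [show n + 2 - 1 = n + 1 by omega] at hmom
  rw [← integral_sub' i1p i2p, ← integral_sub' i1q i2q,
    ← integral_sub (i1p.sub i2p) (i1q.sub i2q), ← hmom.2, ← integral_const_mul]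
  refine integral_mono ((i1p.sub i2p).sub (i1q.sub i2q)) (hmom.1.const_mul _) fun u => ?_
  simp only [Pi.sub_apply]
  have hexp : ∀ (h : EuclideanSpace ℝ (Fin n) → ℝ) z,
      rexp (-(h u - ⟪u, z⟫)) = rexp (-h u) * rexp ⟪u, z⟫ := fun h z => by
    rw [← Real.exp_add]; congr 1; ring
  calc rexp (-(h₁ u - ⟪u, p⟫)) - rexp (-(h₂ u - ⟪u, p⟫)) -
        (rexp (-(h₁ u - ⟪u, q⟫)) - rexp (-(h₂ u - ⟪u, q⟫)))
      = (rexp (-h₁ u) - rexp (-h₂ u)) * (rexp ⟪u, p⟫ - rexp ⟪u, q⟫) := by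
        simp only [hexp]; ring
    _ ≤ |rexp (-h₁ u) - rexp (-h₂ u)| * |rexp ⟪u, p⟫ - rexp ⟪u, q⟫| := by
        rw [← abs_mul]; exact le_abs_self _
    _ ≤ (|-h₁ u - -h₂ u| * rexp (max (-h₁ u) (-h₂ u))) *
          (|⟪u, p⟫ - ⟪u, q⟫| * rexp (max ⟪u, p⟫ ⟪u, q⟫)) := by
        gcongr <;> exact abs_exp_sub_exp_le _ _
    _ = |-h₁ u - -h₂ u| * |⟪u, p⟫ - ⟪u, q⟫| *
          rexp (max (-h₁ u) (-h₂ u) + max ⟪u, p⟫ ⟪u, q⟫) := by rw [Real.exp_add]; ring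
    _ ≤ (η * ‖u‖) * (‖u‖ * ‖p - q‖) * rexp (-(ρ * ‖u‖)) := by
        have hη' : |-h₁ u - -h₂ u| ≤ η * ‖u‖ := by
          rw [show -h₁ u - -h₂ u = -(h₁ u - h₂ u) by ring, abs_neg]; exact hη u
        have hη0 : 0 ≤ η * ‖u‖ := (abs_nonneg _).trans hη'
        gcongr
        · rw [← inner_sub_right]; exact abs_real_inner_le_norm _ _
        · rcases max_choice (-h₁ u) (-h₂ u) with e | e <;>
          rcases max_choice ⟪u, p⟫ ⟪u, q⟫ with e' | e' <;> rw [e, e'] <;>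
          linarith [h1p u, h1q u, h2p u, h2q u]
    _ = _ := by ring

lemma unitBallVol_eq {n : ℕ} (hn : 1 ≤ n) :
    unitBallVol n = √π ^ n / Real.Gamma (n / 2 + 1) := by
  have : Nonempty (Fin n) := ⟨⟨0, hn⟩⟩
  rw [unitBallVol, EuclideanSpace.volume_ball]
  simp only [ENNReal.ofReal_one, one_pow, one_mul, Fintype.card_fin]
  rw [ENNReal.toReal_ofReal]
  have := Real.Gamma_pos_of_pos (s := (n : ℝ) / 2 + 1) (by positivity)
  positivity

lemma unitBallVol_add_two {n : ℕ} (hn : 1 ≤ n) :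
    unitBallVol (n + 2) = unitBallVol n * (2 * π / (n + 2)) := by
  rw [unitBallVol_eq hn, unitBallVol_eq (by omega)]
  have h : ((n + 2 : ℕ) : ℝ) / 2 + 1 = ((n : ℝ) / 2 + 1) + 1 := by push_cast; ring
  have hG := (Real.Gamma_pos_of_pos (s := (n : ℝ) / 2 + 1) (by positivity)).ne'
  rw [h, Real.Gamma_add_one (by positivity), pow_add, Real.sq_sqrt Real.pi_nonneg]
  field_simp

lemma unitBallVol_le {n : ℕ} (hn : 2 ≤ n) : unitBallVol n ≤ π * 2 ^ n / 4 := by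
  induction n using Nat.strong_induction_on with
  | _ n ih =>
    rcases (by omega : n = 2 ∨ n = 3 ∨ 4 ≤ n) with rfl | rfl | h4
    · rw [unitBallVol, EuclideanSpace.volume_ball_fin_two]
      simp [Real.pi_nonneg]
      linarith
    · rw [unitBallVol, EuclideanSpace.volume_ball_fin_three]
      have : 0 ≤ π * 4 / 3 := by positivity
      simp only [ENNReal.ofReal_one, one_pow, one_mul, ENNReal.toReal_ofReal this]
      linarith [Real.pi_pos]
    · obtain ⟨m, rfl⟩ : ∃ m, n = m + 2 := ⟨n - 2, by omega⟩
      rw [unitBallVol_add_two (by omega)]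
      have h1 := ih m (by omega) (by omega)
      have hm : (2 : ℝ) ≤ m := by exact_mod_cast (by omega : 2 ≤ m)
      have h2 : 2 * π / (m + 2) ≤ 4 := by
        rw [div_le_iff₀ (by positivity)]
        linarith [Real.pi_le_four]
      calc unitBallVol m * (2 * π / (m + 2)) ≤ (π * 2 ^ m / 4) * 4 := by gcongr
        _ = _ := by ring
/-- Lower bound for the distance of `p` from the boundary of `K` in terms of the volume product
of `K` with respect to `p`. -/
lemma mul_norm_le_supportFn_sub_of_vol_mul_le {d : ℕ} (hd : 2 ≤ d) {R : ℝ} (hR : 0 < R)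
    {K : Set (EuclideanSpace ℝ (Fin d))} (hK : IsCompact K) {p : EuclideanSpace ℝ (Fin d)}
    (hp : p ∈ interior K) (hKR : ∀ u, supportFn K u + supportFn K (-u) ≤ 2 * R * ‖u‖)
    (hvol : vol K * vol (polarBody ((· - p) '' K)) ≤ unitBallVol d ^ 2)
    (u : EuclideanSpace ℝ (Fin d)) :
    vol K * unitBallVol (d - 1) / (d * unitBallVol d ^ 2 * R ^ (d - 1)) * ‖u‖ ≤
      supportFn K u - ⟪u, p⟫ := by
  obtain ⟨n, rfl⟩ : ∃ n, d = n + 1 := ⟨d - 1, by omega⟩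
  rw [Nat.add_sub_cancel]
  obtain ⟨ρ, hρ, hcoer⟩ := exists_pos_mul_norm_le_supportFn_sub hK hp
  have hne : K.Nonempty := ⟨p, interior_subset hp⟩
  have hκ := unitBallVol_pos (n + 1)
  have hhom : ∀ t : ℝ, 0 ≤ t → ∀ u, supportFn K (t • u) - ⟪t • u, p⟫ =
      t * (supportFn K u - ⟪u, p⟫) := fun t ht u => by
    rw [supportFn_smul ht, real_inner_smul_left]; ring
  have hunit : ∀ u : EuclideanSpace ℝ (Fin (n + 1)), ‖u‖ = 1 →
      vol K * unitBallVol n / ((n + 1 : ℕ) * unitBallVol (n + 1) ^ 2 * R ^ n) ≤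
        supportFn K u - ⟪u, p⟫ := by
    intro u hu
    have h1 := le_mul_integral_exp_neg (n := n) (by omega) hρ hR
      (g := fun u => supportFn K u - ⟪u, p⟫)
      ((continuous_supportFn hK).sub (by fun_prop)) hcoer hhom
      (fun u v => by
        have := supportFn_add_le hK hne u v
        rw [inner_add_left]; linarith)
      (fun u => by rw [inner_neg_left]; linarith [hKR u]) hu
    rw [integral_exp_eq_factorial_mul_vol_polarBody (by omega) hK hp] at h1
    have hg : 0 ≤ supportFn K u - ⟪u, p⟫ := le_trans (by positivity) (hcoer u)
    have hvK : 0 ≤ vol K := ENNReal.toReal_nonneg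
    have h2 : vol K * unitBallVol n * n.factorial / R ^ n ≤
        (supportFn K u - ⟪u, p⟫) * ((n + 1 : ℕ) * unitBallVol (n + 1) ^ 2) * n.factorial := by
      calc vol K * unitBallVol n * n.factorial / R ^ n
          = vol K * (unitBallVol n * (n.factorial / R ^ n)) := by ring
        _ ≤ vol K * ((supportFn K u - ⟪u, p⟫) * ((n + 1).factorial *
              vol (polarBody ((· - p) '' K)))) := by gcongr
        _ = (supportFn K u - ⟪u, p⟫) * (n + 1).factorial *
              (vol K * vol (polarBody ((· - p) '' K))) := by ring
        _ ≤ (supportFn K u - ⟪u, p⟫) * (n + 1).factorial * unitBallVol (n + 1) ^ 2 := by gcongr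
        _ = _ := by rw [Nat.factorial_succ]; push_cast; ring
    have hf : (0 : ℝ) < n.factorial := by positivity
    rw [div_le_iff₀ (by positivity)]
    rw [div_le_iff₀ (by positivity)] at h2
    apply le_of_mul_le_mul_right _ hf
    calc _ ≤ _ := h2
      _ = _ := by ring
  rcases eq_or_ne u 0 with rfl | hu
  · have := hcoer 0
    simpa using this
  have hu' : 0 < ‖u‖ := norm_pos_iff.2 hu
  have h := hunit (‖u‖⁻¹ • u) (by rw [norm_smul, norm_inv, norm_norm, inv_mul_cancel₀ hu'.ne'])
  rw [hhom _ (by positivity), inv_mul_eq_div, le_div_iff₀ hu'] at h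
  exact h

lemma zero_mem_of_smul_subset_smul {d : ℕ} {K : Set (EuclideanSpace ℝ (Fin d))}
    (hK : IsCompact K) (hne : K.Nonempty) {a b : ℝ} (ha : 0 ≤ a) (hab : a < b)
    (h : a • K ⊆ b • K) : (0 : EuclideanSpace ℝ (Fin d)) ∈ K := by
  obtain ⟨x, hx, hmin⟩ := hK.exists_isMinOn hne continuous_norm.continuousOn
  obtain ⟨y, hy, hyx⟩ := h (Set.smul_mem_smul_set (a := a) hx)
  have hxy : ‖x‖ ≤ ‖y‖ := hmin hy
  have h1 : b * ‖y‖ = a * ‖x‖ := by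
    have := congrArg norm hyx
    simpa [norm_smul, abs_of_nonneg ha, abs_of_nonneg (ha.trans hab.le)] using this
  have h2 : ‖x‖ = 0 := by
    by_contra hne
    have : 0 < ‖x‖ := lt_of_le_of_ne (norm_nonneg _) (Ne.symm hne)
    nlinarith
  rwa [norm_eq_zero.1 h2] at hx

/-- A point at which the support function of a compact convex set is strictly coercive
lies in its interior. -/
lemma mem_interior_of_mul_norm_le_supportFn_sub {d : ℕ} {K : Set (EuclideanSpace ℝ (Fin d))}
    (hK : IsCompact K) (hconv : Convex ℝ K) (hne : K.Nonempty) {r : ℝ} (hr : 0 < r)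
    {z : EuclideanSpace ℝ (Fin d)} (h : ∀ u, r * ‖u‖ ≤ supportFn K u - ⟪u, z⟫) :
    z ∈ interior K := by
  refine mem_interior.2 ⟨Metric.ball z r, fun x hx => ?_, Metric.isOpen_ball,
    Metric.mem_ball_self hr⟩
  by_contra hxK
  obtain ⟨f, a, hfK, hfx⟩ := geometric_hahn_banach_closed_point hconv hK.isClosed hxK
  set u := (InnerProductSpace.toDual ℝ _).symm f with hu
  have hf : ∀ y, f y = ⟪u, y⟫ := fun y => by
    rw [hu, InnerProductSpace.toDual_symm_apply]
  have h1 : supportFn K u ≤ a := (supportFn_le_iff hK hne).2 fun y hy => by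
    rw [← hf]; exact (hfK y hy).le
  have h2 : ⟪u, x⟫ - ⟪u, z⟫ ≤ ‖u‖ * r := by
    rw [← inner_sub_right]
    refine (real_inner_le_norm _ _).trans ?_
    gcongr
    rw [← dist_eq_norm]
    exact (Metric.mem_ball.1 hx).le
  have h3 := h u
  rw [hf] at hfx
  linarith

/-- The numerical estimate relating the inner radius at both Santaló points to the constants. -/
lemma inner_radius_estimate {d : ℕ} (hd : 2 ≤ d) {D P ε κ : ℝ} (hP : 0 < P)
    (hε : 0 < ε) (hκ0 : 0 < κ) (hκ : κ ≤ π * 2 ^ d / 4)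
    (hεD : ε * D ≤ P / 2 ^ (2 * d + 1)) (hPD : 2 ^ (d - 1) * P ≤ D) :
    ε ≤ 1 / 64 ∧ (1.1 / 2) * (1 + ε) * (κ * P) ≤
      2 ^ (d - 1) * P * ((1 - ε) ^ d / (1 + ε) ^ (d - 1)) - ε * D := by
  obtain ⟨n, rfl⟩ : ∃ n, d = n + 1 := ⟨d - 1, by omega⟩
  rw [Nat.add_sub_cancel] at *
  have hn : 1 ≤ n := by omega
  have h8 : (2 * n + 1 : ℝ) * 64 ≤ 3 * 8 ^ (n + 1) := by
    clear hd hκ0 hκ hεD hPD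
    induction n, hn using Nat.le_induction with
    | base => norm_num
    | succ m hm ih =>
      rw [pow_succ]
      push_cast
      have : (1 : ℝ) ≤ m := by exact_mod_cast hm
      linarith
  have h64 : (64 : ℝ) ≤ 8 ^ (n + 1) := by
    calc (64 : ℝ) = 8 ^ 2 := by norm_num
      _ ≤ 8 ^ (n + 1) := pow_le_pow_right₀ (by norm_num) hd
  have hpow : (2 : ℝ) ^ (2 * (n + 1) + 1) * 2 ^ n = 8 ^ (n + 1) := by
    rw [show (8 : ℝ) = 2 ^ 3 by norm_num, ← pow_mul, ← pow_add]; congr 1; ring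
  have hε8 : ε * 8 ^ (n + 1) ≤ 1 := by
    rw [le_div_iff₀ (by positivity)] at hεD
    have : ε * 8 ^ (n + 1) * P ≤ 1 * P := by
      calc ε * 8 ^ (n + 1) * P = ε * (2 ^ n * P) * 2 ^ (2 * (n + 1) + 1) := by rw [← hpow]; ring
        _ ≤ ε * D * 2 ^ (2 * (n + 1) + 1) := by gcongr
        _ ≤ 1 * P := by linarith
    exact le_of_mul_le_mul_right this hP
  have hε64 : ε ≤ 1 / 64 := by nlinarith
  have hεn : (2 * n + 1) * ε ≤ 3 / 64 := by nlinarith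
  refine ⟨hε64, ?_⟩
  have hq : 61 / 64 ≤ (1 - ε) ^ (n + 1) / (1 + ε) ^ n := by
    have hB := one_add_mul_le_pow (a := -ε) (by linarith) (2 * n + 1)
    have h1 : (1 - ε) ^ n * (1 + ε) ^ n ≤ 1 := by
      rw [← mul_pow]
      exact pow_le_one₀ (by nlinarith) (by nlinarith)
    have h2 : (1 - ε) ^ (2 * n + 1) ≤ (1 - ε) ^ (n + 1) / (1 + ε) ^ n := by
      rw [le_div_iff₀ (by positivity)]
      have h0 : 0 ≤ (1 - ε) ^ (n + 1) := pow_nonneg (by linarith) _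
      calc (1 - ε) ^ (2 * n + 1) * (1 + ε) ^ n
          = (1 - ε) ^ (n + 1) * ((1 - ε) ^ n * (1 + ε) ^ n) := by ring
        _ ≤ (1 - ε) ^ (n + 1) * 1 := by gcongr
        _ = _ := mul_one _
    refine le_trans ?_ h2
    rw [← sub_eq_add_neg] at hB
    push_cast at hB
    linarith
  have h2n : (2 : ℝ) ≤ 2 ^ n := by
    calc (2 : ℝ) = 2 ^ 1 := by norm_num
      _ ≤ 2 ^ n := pow_le_pow_right₀ (by norm_num) hn
  have hεD' : ε * D ≤ P * 2 ^ n / 64 := by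
    refine hεD.trans ?_
    rw [div_le_div_iff₀ (by positivity) (by norm_num)]
    have : (64 : ℝ) ≤ 2 ^ n * 2 ^ (2 * (n + 1) + 1) := by rw [mul_comm, hpow]; exact h64
    rw [mul_assoc]
    gcongr
  have hπ : π < 3.15 := Real.pi_lt_d2
  have hκ' : κ ≤ 3.15 / 2 * 2 ^ n := by
    refine hκ.trans ?_
    rw [pow_succ]
    nlinarith
  have hT : 0 < 2 ^ n * P := by positivity
  calc (1.1 / 2) * (1 + ε) * (κ * P) ≤ (1.1 / 2) * (1 + 1 / 64) * (3.15 / 2 * 2 ^ n * P) := by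
        gcongr
    _ ≤ 2 ^ n * P * (61 / 64) - P * 2 ^ n / 64 := by nlinarith
    _ ≤ _ := by
        have := mul_le_mul_of_nonneg_left hq hT.le
        linarith

lemma le_of_sq_estimate {d : ℕ} (hd : 2 ≤ d) {W D P κ ε R ρ M : ℝ} (hW : 0 ≤ W) (hD : 0 < D)
    (hP : 0 < P) (hκ : 0 < κ) (hε : 0 < ε) (hM : 0 < M) (hR : R = (1 + ε) * D / 2)
    (hρ : (1.1 / 2) * (1 + ε) * (κ * P) ≤ ρ)
    (h : 3 / 4 * W ^ 2 * (κ * (M / R ^ (d + 2))) ≤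
      ε * D * W * (d * κ * (M / ρ ^ (d + 2)))) :
    W ≤ d * ε * D * (D / (κ * P)) ^ (d + 2) := by
  rcases hW.eq_or_lt with rfl | hW
  · positivity
  have hρ0 : 0 < ρ := lt_of_lt_of_le (by positivity) hρ
  have hR0 : 0 < R := by rw [hR]; positivity
  have h1 : W ≤ 4 / 3 * (d * ε * D * (R / ρ) ^ (d + 2)) := by
    rw [div_pow]
    have hc : 0 < W * κ * M / R ^ (d + 2) := by positivity
    apply le_of_mul_le_mul_right _ hc
    calc W * (W * κ * M / R ^ (d + 2))
        = 4 / 3 * (3 / 4 * W ^ 2 * (κ * (M / R ^ (d + 2)))) := by ring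
      _ ≤ 4 / 3 * (ε * D * W * (d * κ * (M / ρ ^ (d + 2)))) := by gcongr
      _ = _ := by field_simp
  have h2 : R / ρ ≤ D / (κ * P) / 1.1 := by
    rw [div_div, div_le_div_iff₀ hρ0 (by positivity), hR]
    calc (1 + ε) * D / 2 * (κ * P * 1.1) = D * ((1.1 / 2) * (1 + ε) * (κ * P)) := by ring
      _ ≤ D * ρ := by gcongr
  have h3 : (4 / 3 : ℝ) ≤ 1.1 ^ (d + 2) := by
    calc (4 / 3 : ℝ) ≤ 1.1 ^ 4 := by norm_num
      _ ≤ 1.1 ^ (d + 2) := pow_le_pow_right₀ (by norm_num) (by omega)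
  calc W ≤ 4 / 3 * (d * ε * D * (R / ρ) ^ (d + 2)) := h1
    _ ≤ 4 / 3 * (d * ε * D * (D / (κ * P) / 1.1) ^ (d + 2)) := by gcongr
    _ = d * ε * D * (D / (κ * P)) ^ (d + 2) * ((4 / 3) / 1.1 ^ (d + 2)) := by
        rw [div_pow _ (1.1 : ℝ)]; ring
    _ ≤ d * ε * D * (D / (κ * P)) ^ (d + 2) * 1 := by
        gcongr
        exact (div_le_one (by positivity)).2 h3
    _ = _ := mul_one _

/-- The passage from quadratic growth of the polar volume to a distance estimate. -/
lemma le_sqrt_mul_sqrt_of_sq_growth {d : ℕ} {Z D R κ V V₀ v w ε : ℝ} (hD : 0 < D)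
    (hR : 0 < R) (hRD : R ≤ D) (hκ : 0 < κ) (hV₀ : 0 < V₀) (hV : (1 / 2) ^ d * V₀ ≤ V)
    (hvw : V * (w - v) ≤ ε)
    (h : d.factorial * v + 3 / 8 * Z ^ 2 * (κ * ((d + 1).factorial / R ^ (d + 2))) ≤
      d.factorial * w) :
    Z ≤ √(D ^ (d + 2) / V₀) * √(2 ^ (d + 3) / ((d + 1) * κ)) * √ε := by
  rw [← Real.sqrt_mul (by positivity), ← Real.sqrt_mul (by positivity)]
  refine (le_abs_self Z).trans (Real.abs_le_sqrt ?_)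
  have hf : (0 : ℝ) < d.factorial := by positivity
  have hV0 : 0 ≤ V := le_trans (by positivity) hV
  have h1 : 3 / 8 * Z ^ 2 * κ * (d + 1) / R ^ (d + 2) ≤ w - v := by
    apply le_of_mul_le_mul_left _ hf
    calc d.factorial * (3 / 8 * Z ^ 2 * κ * (d + 1) / R ^ (d + 2))
        = 3 / 8 * Z ^ 2 * (κ * ((d + 1).factorial / R ^ (d + 2))) := by
          rw [Nat.factorial_succ]; push_cast; ring
      _ ≤ _ := by linarith
  have h2 : (1 / 2) ^ d * V₀ * (1 / 8 * Z ^ 2 * κ * (d + 1) / D ^ (d + 2)) ≤ ε := by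
    have hle : 1 / 8 * Z ^ 2 * κ * (d + 1) / D ^ (d + 2) ≤ w - v := by
      refine le_trans ?_ h1
      gcongr
      norm_num
    calc _ ≤ V * (w - v) := by gcongr
      _ ≤ ε := hvw
  calc Z ^ 2 = D ^ (d + 2) / V₀ * (2 ^ (d + 3) / ((d + 1) * κ)) *
        ((1 / 2) ^ d * V₀ * (1 / 8 * Z ^ 2 * κ * (d + 1) / D ^ (d + 2))) := by
        rw [pow_add 2 d 3, one_div_pow]; field_simp; norm_num
    _ ≤ _ := by gcongr

/-- Second part of the Santaló-point stability lemma: under the hypotheses of the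
first part, if moreover `|K₀|·|(K₀−s(K₀))*| ≤ |K|·|(K−s(K))*|` and `c ∈ int K`
satisfies `|K|·|(K−c)*| ≤ |K₀|·|(K₀−s(K₀))*| + ε₂ ≤ κ_d²`, then
`‖c − s(K₀)‖ ≤ c₁(K₀)·ε₁ + c₂(K₀)·√ε₂`. -/
theorem santalo_point_stability_centre (d : ℕ) (hd : 2 ≤ d)
    (K0 K : Set (EuclideanSpace ℝ (Fin d)))
    (hK0 : IsConvexBody K0) (hK : IsConvexBody K)
    (ε1 : ℝ) (hε1 : 0 < ε1)
    (hε1le : ε1 ≤ min (1 / 2)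
      ((1 / 2 ^ (2 * d + 1)) * (unitBallVol (d - 1) / (d * unitBallVol d ^ 2)) *
        (vol K0 / Metric.diam K0 ^ d)))
    (hsub1 : (1 - ε1) • K0 ⊆ K) (hsub2 : K ⊆ (1 + ε1) • K0)
    (sK sK0 : EuclideanSpace ℝ (Fin d))
    (hsK : IsSantaloPoint K sK) (hsK0 : IsSantaloPoint K0 sK0)
    (ε2 : ℝ) (hε2 : 0 < ε2)
    (hmono : vol K0 * vol (polarBody ((· - sK0) '' K0)) ≤
      vol K * vol (polarBody ((· - sK) '' K)))
    (c : EuclideanSpace ℝ (Fin d)) (hc : c ∈ interior K)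
    (hcbound : vol K * vol (polarBody ((· - c) '' K)) ≤
      vol K0 * vol (polarBody ((· - sK0) '' K0)) + ε2)
    (hkappa : vol K0 * vol (polarBody ((· - sK0) '' K0)) + ε2 ≤ unitBallVol d ^ 2) :
    ‖c - sK0‖ ≤
      (Metric.diam K0 ^ ((d + 1) ^ 2) / vol K0 ^ (d + 2)) * d *
          (d * unitBallVol d / unitBallVol (d - 1)) ^ (d + 2) * ε1 +
        Real.sqrt (Metric.diam K0 ^ (d + 2) / vol K0) *
          Real.sqrt (2 ^ (d + 3) / ((d + 1) * unitBallVol d)) * Real.sqrt ε2 := by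
  have hd1 : 1 ≤ d := by omega
  have hK0c := hK0.2.1
  have hKc := hK.2.1
  have hs0 := hsK0.1
  have hs := hsK.1
  have hne0 : K0.Nonempty := ⟨_, interior_subset hs0⟩
  have hne : K.Nonempty := ⟨_, interior_subset hs⟩
  have hε12 : ε1 ≤ 1 / 2 := hε1le.trans (min_le_left _ _)
  have hε1b := hε1le.trans (min_le_right _ _)
  set D := Metric.diam K0 with hDdef
  set κ := unitBallVol d with hκdef
  set κ' := unitBallVol (d - 1) with hκ'def
  have hκ : 0 < κ := unitBallVol_pos d
  have hκ' : 0 < κ' := unitBallVol_pos (d - 1)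
  have hv0 : 0 < vol K0 :=
    ENNReal.toReal_pos (Measure.measure_pos_of_nonempty_interior _ ⟨_, hs0⟩).ne'
      hK0c.measure_lt_top.ne
  have hvK : (1 - ε1) ^ d * vol K0 ≤ vol K := by
    have h1 : vol ((1 - ε1) • K0) ≤ vol K :=
      ENNReal.toReal_mono hKc.measure_lt_top.ne (measure_mono hsub1)
    refine le_trans (le_of_eq ?_) h1
    rw [vol, vol, Measure.addHaar_smul, ENNReal.toReal_mul, finrank_euclideanSpace,
      Fintype.card_fin, abs_of_nonneg (pow_nonneg (by linarith) _),
      ENNReal.toReal_ofReal (pow_nonneg (by linarith) _)]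
  have hvK0 : 0 < vol K := lt_of_lt_of_le (mul_pos (pow_pos (by linarith) _) hv0) hvK
  have hzero : (0 : EuclideanSpace ℝ (Fin d)) ∈ K0 :=
    zero_mem_of_smul_subset_smul hK0c hne0 (by linarith) (by linarith) (hsub1.trans hsub2)
  have hh0 : ∀ u, 0 ≤ supportFn K0 u := fun u => by
    simpa using inner_le_supportFn hK0c hzero u
  have hh0D : ∀ u, supportFn K0 u ≤ D * ‖u‖ := fun u => by
    simpa using supportFn_sub_inner_le hK0c hzero u
  have hhle : ∀ u, supportFn K u ≤ (1 + ε1) * supportFn K0 u := fun u => by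
    rw [← supportFn_smul_set (by linarith)]
    exact supportFn_mono (hK0c.smul _) hne hsub2 u
  have hhge : ∀ u, (1 - ε1) * supportFn K0 u ≤ supportFn K u := fun u => by
    rw [← supportFn_smul_set (by linarith)]
    exact supportFn_mono hKc hne0.smul_set hsub1 u
  have hdiff : ∀ u, |supportFn K u - supportFn K0 u| ≤ (ε1 * D) * ‖u‖ := fun u => by
    have := mul_le_mul_of_nonneg_left (hh0D u) hε1.le
    rw [abs_le]
    constructor <;> linarith [hhle u, hhge u]
  have hD : 0 < D := by
    obtain ⟨r, hr, hcoer⟩ := exists_pos_mul_norm_le_supportFn_sub hK0c hs0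
    have : Nonempty (Fin d) := ⟨⟨0, by omega⟩⟩
    obtain ⟨e, he⟩ := exists_norm_eq (EuclideanSpace ℝ (Fin d)) zero_le_one
    have h1 := hcoer e
    have h2 := supportFn_sub_inner_le hK0c (interior_subset hs0) e
    rw [he] at h1 h2
    linarith
  set R := (1 + ε1) * D / 2 with hRdef
  have hR : 0 < R := by positivity
  have hwid0 : ∀ u, supportFn K0 u + supportFn K0 (-u) ≤ 2 * (D / 2) * ‖u‖ := fun u => by
    have := supportFn_add_neg_le hK0c hne0 u
    linarith
  have hwid : ∀ u, supportFn K u + supportFn K (-u) ≤ 2 * R * ‖u‖ := fun u => by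
    have h1 := mul_le_mul_of_nonneg_left (hwid0 u) (by linarith : 0 ≤ 1 + ε1)
    have e : 2 * R * ‖u‖ = (1 + ε1) * (2 * (D / 2) * ‖u‖) := by rw [hRdef]; ring
    rw [e]
    linarith [hhle u, hhle (-u)]
  have hwid0' : ∀ u, supportFn K0 u + supportFn K0 (-u) ≤ 2 * R * ‖u‖ := fun u => by
    refine (hwid0 u).trans ?_
    have : D / 2 ≤ R := by rw [hRdef]; nlinarith
    gcongr
  have hprod0 : vol K0 * vol (polarBody ((· - sK0) '' K0)) ≤ κ ^ 2 := by linarith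
  have hprod : vol K * vol (polarBody ((· - sK) '' K)) ≤ κ ^ 2 :=
    (mul_le_mul_of_nonneg_left (hsK.2 c hc) hvK0.le).trans (hcbound.trans hkappa)
  have hr0 := mul_norm_le_supportFn_sub_of_vol_mul_le hd (by positivity : 0 < D / 2) hK0c hs0
    hwid0 hprod0
  have hr := mul_norm_le_supportFn_sub_of_vol_mul_le hd hR hKc hs hwid hprod
  set P := vol K0 * κ' / (d * κ ^ 2 * D ^ (d - 1)) with hPdef
  have hd0 : (0 : ℝ) < d := by exact_mod_cast (by omega : 0 < d)
  have hP : 0 < P := by positivity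
  have er0 : vol K0 * κ' / (d * κ ^ 2 * (D / 2) ^ (d - 1)) = 2 ^ (d - 1) * P := by
    rw [hPdef, div_pow]; field_simp
  have hDd : D ^ d = D ^ (d - 1) * D := by rw [← pow_succ]; congr 1; omega
  have hεD : ε1 * D ≤ P / 2 ^ (2 * d + 1) := by
    calc ε1 * D ≤ (1 / 2 ^ (2 * d + 1) * (κ' / (d * κ ^ 2)) * (vol K0 / D ^ d)) * D := by gcongr
      _ = _ := by rw [hDd, hPdef]; field_simp
  have hPD : 2 ^ (d - 1) * P ≤ D := by
    have : Nonempty (Fin d) := ⟨⟨0, by omega⟩⟩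
    obtain ⟨e, he⟩ := exists_norm_eq (EuclideanSpace ℝ (Fin d)) zero_le_one
    have h1 := hr0 e
    have h2 := supportFn_sub_inner_le hK0c (interior_subset hs0) e
    rw [er0] at h1
    rw [he] at h1 h2
    linarith
  obtain ⟨hε64, hρest⟩ := inner_radius_estimate hd hP hε1 hκ (unitBallVol_le hd) hεD hPD
  set q := (1 - ε1) ^ d / (1 + ε1) ^ (d - 1) with hqdef
  set ρ := 2 ^ (d - 1) * P * q - ε1 * D with hρdef
  have hρ : 0 < ρ := lt_of_lt_of_le (by positivity) hρest
  have hq1 : q ≤ 1 := by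
    rw [hqdef, div_le_one (by positivity)]
    exact (pow_le_one₀ (by linarith) (by linarith)).trans (one_le_pow₀ (by linarith))
  have hcoer0 : ∀ u, (ρ + ε1 * D) * ‖u‖ ≤ supportFn K0 u - ⟪u, sK0⟫ := fun u => by
    refine le_trans ?_ (hr0 u)
    rw [er0]
    gcongr
    rw [hρdef, sub_add_cancel]
    exact mul_le_of_le_one_right (by positivity) hq1
  have hcoer : ∀ u, (ρ + ε1 * D) * ‖u‖ ≤ supportFn K u - ⟪u, sK⟫ := fun u => by
    refine le_trans ?_ (hr u)
    gcongr
    rw [hρdef, sub_add_cancel]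
    calc 2 ^ (d - 1) * P * q
        = ((1 - ε1) ^ d * vol K0) * κ' / (d * κ ^ 2 * R ^ (d - 1)) := by
          rw [hPdef, hqdef, hRdef, div_pow, mul_pow]; field_simp
      _ ≤ _ := by gcongr
  have hεDu : ∀ u : EuclideanSpace ℝ (Fin d), 0 ≤ ε1 * D * ‖u‖ := fun u => by positivity
  have hI : ∀ z ∈ interior K, ∫ u, rexp (-(supportFn K u - ⟪u, z⟫)) =
      d.factorial * vol (polarBody ((· - z) '' K)) := fun z hz =>
    integral_exp_eq_factorial_mul_vol_polarBody hd1 hKc hz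
  have hI0 : ∀ z ∈ interior K0, ∫ u, rexp (-(supportFn K0 u - ⟪u, z⟫)) =
      d.factorial * vol (polarBody ((· - z) '' K0)) := fun z hz =>
    integral_exp_eq_factorial_mul_vol_polarBody hd1 hK0c hz
  have c00 : ∀ u, ρ * ‖u‖ ≤ supportFn K0 u - ⟪u, sK0⟫ := fun u => by
    linarith [hcoer0 u, hεDu u]
  have c11 : ∀ u, ρ * ‖u‖ ≤ supportFn K u - ⟪u, sK⟫ := fun u => by
    linarith [hcoer u, hεDu u]
  have c01 : ∀ u, ρ * ‖u‖ ≤ supportFn K0 u - ⟪u, sK⟫ := fun u => by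
    linarith [hcoer u, (abs_le.1 (hdiff u)).2]
  have c10 : ∀ u, ρ * ‖u‖ ≤ supportFn K u - ⟪u, sK0⟫ := fun u => by
    linarith [hcoer0 u, (abs_le.1 (hdiff u)).1]
  have hs01 : sK ∈ interior K0 :=
    mem_interior_of_mul_norm_le_supportFn_sub hK0c hK0.1 hne0 hρ c01
  have hs10 : sK0 ∈ interior K :=
    mem_interior_of_mul_norm_le_supportFn_sub hKc hK.1 hne hρ c10
  have hgrow : ∀ z ∈ interior K, (∫ u, rexp (-(supportFn K u - ⟪u, sK⟫))) +
        3 / 8 * ‖sK - z‖ ^ 2 * (κ * ((d + 1).factorial / R ^ (d + 2))) ≤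
      ∫ u, rexp (-(supportFn K u - ⟪u, z⟫)) := fun z hz =>
    quadratic_growth_of_isMinOn hd1 hR (continuous_supportFn hKc) hwid hK.1.interior
      (fun p hp => exists_pos_mul_norm_le_supportFn_sub hKc hp) hs
      (fun p hp => by rw [hI _ hs, hI _ hp]; gcongr; exact hsK.2 p hp) hz
  have hgrow0 : (∫ u, rexp (-(supportFn K0 u - ⟪u, sK0⟫))) +
        3 / 8 * ‖sK0 - sK‖ ^ 2 * (κ * ((d + 1).factorial / R ^ (d + 2))) ≤
      ∫ u, rexp (-(supportFn K0 u - ⟪u, sK⟫)) :=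
    quadratic_growth_of_isMinOn hd1 hR (continuous_supportFn hK0c) hwid0' hK0.1.interior
      (fun p hp => exists_pos_mul_norm_le_supportFn_sub hK0c hp) hs0
      (fun p hp => by rw [hI0 _ hs0, hI0 _ hp]; gcongr; exact hsK0.2 p hp) hs01
  have hW : ‖sK - sK0‖ ≤ d * ε1 * D * (D / (κ * P)) ^ (d + 2) := by
    have h1 := integral_exp_sub_sub_le hd1 hρ (continuous_supportFn hKc)
      (continuous_supportFn hK0c) hdiff c10 c11 c00 c01
    have h2 := hgrow _ hs10
    rw [norm_sub_rev] at hgrow0 h1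
    exact le_of_sq_estimate (M := (d + 1).factorial) hd (norm_nonneg _) hD hP hκ hε1
      (by positivity) hRdef hρest (by linarith)
  have hZ : ‖sK - c‖ ≤ √(D ^ (d + 2) / vol K0) * √(2 ^ (d + 3) / ((d + 1) * κ)) * √ε2 := by
    have h1 := hgrow c hc
    rw [hI _ hs, hI _ hc] at h1
    refine le_sqrt_mul_sqrt_of_sq_growth (V := vol K) hD hR (by rw [hRdef]; nlinarith) hκ hv0 ?_
      (by rw [mul_sub]; linarith) h1
    refine le_trans ?_ hvK
    gcongr
    linarith
  have hc1 : D ^ ((d + 1) ^ 2) / vol K0 ^ (d + 2) * d * (d * κ / κ') ^ (d + 2) * ε1 =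
      d * ε1 * D * (D / (κ * P)) ^ (d + 2) := by
    have hquot : D / (κ * P) = D ^ d / vol K0 * (d * κ / κ') := by
      rw [hDd, hPdef]; field_simp
    have hpow : D ^ ((d + 1) ^ 2) = D * (D ^ d) ^ (d + 2) := by
      rw [← pow_mul, ← pow_succ']; congr 1; ring
    rw [hquot, hpow, mul_pow, div_pow (D ^ d)]
    ring
  rw [hc1]
  calc ‖c - sK0‖ ≤ ‖c - sK‖ + ‖sK - sK0‖ := norm_sub_le_norm_sub_add_norm_sub _ _ _
    _ ≤ _ := by rw [norm_sub_rev c]; linarith
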